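/- arXiv:1909.13455 — 4 statements merged into one kernel-verified Lean document; each statement's English description precedes it below -/
import Mathlib

section
/- Let ψ : ℝ → ℝ be differentiable and suppose the function Ψ(a,b) = ψ(a) ψ'(b) is Lipschitz on ℝ² (Euclidean norm) with constant L_Ψ. Then for any vectors u, v ∈ ℝ^d and matrices W¹, W² ∈ ℝ^{m×d}: ‖ψ(W¹ u) ⊙ ψ'(W¹ v) − ψ(W² u) ⊙ ψ'(W² v)‖₂² ≤ 2 L_Ψ² (‖u‖₂² + ‖v‖₂²) ‖W¹ − W²‖_F², where ψ and ψ' are applied entrywise and ⊙ denotes the entrywise product of vectors. -/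
open scoped BigOperators

/-- If `Ψ(a,b) = ψ(a) ψ'(b)` is Lipschitz on `ℝ²` with constant `L_Ψ`, then for any
`u, v ∈ ℝ^d` and `W¹, W² ∈ ℝ^{m×d}`,
`‖ψ(W¹u) ⊙ ψ'(W¹v) − ψ(W²u) ⊙ ψ'(W²v)‖₂² ≤ 2 L_Ψ² (‖u‖₂² + ‖v‖₂²) ‖W¹ − W²‖_F²`,
with `ψ, ψ'` applied entrywise.  Squared norms are written as sums of squares. -/
theorem hadamard_diff_sq_le {d m : ℕ} (ψ : ℝ → ℝ) (hψ : Differentiable ℝ ψ) (LΨ : ℝ)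
    (hLip : ∀ a₁ b₁ a₂ b₂ : ℝ,
      |ψ a₁ * deriv ψ b₁ - ψ a₂ * deriv ψ b₂|
        ≤ LΨ * Real.sqrt ((a₁ - a₂) ^ 2 + (b₁ - b₂) ^ 2))
    (u v : Fin d → ℝ) (W₁ W₂ : Fin m → Fin d → ℝ) :
    ∑ j : Fin m,
      (ψ (∑ k : Fin d, W₁ j k * u k) * deriv ψ (∑ k : Fin d, W₁ j k * v k)
        - ψ (∑ k : Fin d, W₂ j k * u k) * deriv ψ (∑ k : Fin d, W₂ j k * v k)) ^ 2
      ≤ 2 * LΨ ^ 2 * ((∑ k : Fin d, u k ^ 2) + ∑ k : Fin d, v k ^ 2)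
        * ∑ j : Fin m, ∑ k : Fin d, (W₁ j k - W₂ j k) ^ 2 := by
  have row_diff_sq_le (w : Fin d → ℝ) (j : Fin m) :
      ((∑ k, W₁ j k * w k) - ∑ k, W₂ j k * w k) ^ 2
        ≤ (∑ k, (W₁ j k - W₂ j k) ^ 2) * ∑ k, w k ^ 2 := by
    rw [← Finset.sum_sub_distrib]
    simp_rw [← sub_mul]
    exact Finset.sum_mul_sq_le_sq_mul_sq _ _ _
  rw [Finset.mul_sum]
  refine Finset.sum_le_sum fun j _ => ?_
  have hu := row_diff_sq_le u j
  have hv := row_diff_sq_le v j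
  have h := hLip (∑ k, W₁ j k * u k) (∑ k, W₁ j k * v k) (∑ k, W₂ j k * u k) (∑ k, W₂ j k * v k)
  have h_sq := pow_le_pow_left₀ (abs_nonneg _) h 2
  rw [sq_abs, mul_pow, Real.sq_sqrt (by positivity)] at h_sq
  have h_scaled := mul_le_mul_of_nonneg_left (add_le_add hu hv) (sq_nonneg LΨ)
  have h_nonneg : 0 ≤ LΨ ^ 2 * ((∑ k, u k ^ 2) + ∑ k, v k ^ 2)
      * ∑ k, (W₁ j k - W₂ j k) ^ 2 := by positivity
  linarith
end

section
/- Let ψ : ℝ → ℝ be differentiable and suppose the function Ψ(a,b) = ψ(a) ψ'(b) is Lipschitz on ℝ² (Euclidean norm) with constant L_Ψ. Let K ∈ ℝ^{m×m} satisfy ‖K‖_F ≤ U_K with m ≥ 1. Then for any vector v ∈ ℝ^d and matrices W¹, W² ∈ ℝ^{m×d}: ‖(K ψ(W¹ v)) ⊙ ψ'(W¹ v) − (K ψ(W² v)) ⊙ ψ'(W² v)‖₂² ≤ 2 m U_K² L_Ψ² ‖v‖₂² ‖W¹ − W²‖_F², where ψ and ψ' are applied entrywise and ⊙ denotes the entrywise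 product of vectors. -/
open scoped BigOperators

/-- Squared form of a Lipschitz bound for the Euclidean norm on the plane. -/
theorem sq_le_of_abs_le_mul_sqrt {t L s : ℝ} (hs : 0 ≤ s) (h : |t| ≤ L * Real.sqrt s) :
    t ^ 2 ≤ L ^ 2 * s := by
  calc t ^ 2 = |t| ^ 2 := (sq_abs t).symm
    _ ≤ (L * Real.sqrt s) ^ 2 := pow_le_pow_left₀ (abs_nonneg t) h 2
    _ = L ^ 2 * s := by rw [mul_pow, Real.sq_sqrt hs]

/-- Cauchy-Schwarz, row by row: `‖A v - B v‖₂² ≤ ‖v‖₂² ‖A - B‖_F²`. -/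
theorem sum_sq_sum_mul_sub_le {ι κ : Type*} [Fintype ι] [Fintype κ] (A B : ι → κ → ℝ)
    (v : κ → ℝ) :
    ∑ j, (∑ k, A j k * v k - ∑ k, B j k * v k) ^ 2
      ≤ (∑ k, v k ^ 2) * ∑ j, ∑ k, (A j k - B j k) ^ 2 := by
  rw [Finset.mul_sum]
  refine Finset.sum_le_sum fun j _ => ?_
  rw [← Finset.sum_sub_distrib, mul_comm]
  simp_rw [← sub_mul]
  exact Finset.sum_mul_sq_le_sq_mul_sq _ _ _

/-- If `Ψ(a,b) = ψ(a) ψ'(b)` is Lipschitz on `ℝ²` with constant `L_Ψ` and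
`‖K‖_F ≤ U_K` with `m ≥ 1`, then for any `v ∈ ℝ^d` and `W¹, W² ∈ ℝ^{m×d}`,
`‖(K ψ(W¹v)) ⊙ ψ'(W¹v) − (K ψ(W²v)) ⊙ ψ'(W²v)‖₂² ≤ 2 m U_K² L_Ψ² ‖v‖₂² ‖W¹ − W²‖_F²`,
with `ψ, ψ'` applied entrywise.  Squared norms are written as sums of squares, and the
Frobenius norm of `K` is the Euclidean norm on `Fin m × Fin m`. -/
theorem K_hadamard_diff_sq_le {d m : ℕ} (hm : 1 ≤ m) (ψ : ℝ → ℝ)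
    (hψ : Differentiable ℝ ψ) (LΨ : ℝ)
    (hLip : ∀ a₁ b₁ a₂ b₂ : ℝ,
      |ψ a₁ * deriv ψ b₁ - ψ a₂ * deriv ψ b₂|
        ≤ LΨ * Real.sqrt ((a₁ - a₂) ^ 2 + (b₁ - b₂) ^ 2))
    (K : EuclideanSpace ℝ (Fin m × Fin m)) (UK : ℝ) (hK : ‖K‖ ≤ UK)
    (v : Fin d → ℝ) (W₁ W₂ : Fin m → Fin d → ℝ) :
    ∑ j : Fin m,
      ((∑ l : Fin m, K (j, l) * ψ (∑ k : Fin d, W₁ l k * v k))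
          * deriv ψ (∑ k : Fin d, W₁ j k * v k)
        - (∑ l : Fin m, K (j, l) * ψ (∑ k : Fin d, W₂ l k * v k))
          * deriv ψ (∑ k : Fin d, W₂ j k * v k)) ^ 2
      ≤ 2 * (m : ℝ) * UK ^ 2 * LΨ ^ 2 * (∑ k : Fin d, v k ^ 2)
        * ∑ j : Fin m, ∑ k : Fin d, (W₁ j k - W₂ j k) ^ 2 := by
  set x : Fin m → ℝ := fun j => ∑ k, W₁ j k * v k
  set y : Fin m → ℝ := fun j => ∑ k, W₂ j k * v k
  set S : ℝ := ∑ j, (x j - y j) ^ 2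
  have hm' : (1 : ℝ) ≤ m := by exact_mod_cast hm
  have hS : 0 ≤ S := Finset.sum_nonneg fun j _ => sq_nonneg _
  have hSW : S ≤ (∑ k, v k ^ 2) * ∑ j, ∑ k, (W₁ j k - W₂ j k) ^ 2 :=
    sum_sq_sum_mul_sub_le W₁ W₂ v
  have hKsq : ∑ j, ∑ l, K (j, l) ^ 2 ≤ UK ^ 2 := by
    rw [← Fintype.sum_prod_type' (f := fun j l => K (j, l) ^ 2), ← EuclideanSpace.real_norm_sq_eq]
    exact pow_le_pow_left₀ (norm_nonneg K) hK 2
  have hD : ∀ j, ∑ l, (ψ (x l) * deriv ψ (x j) - ψ (y l) * deriv ψ (y j)) ^ 2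
      ≤ 2 * m * LΨ ^ 2 * S := by
    intro j
    have hj : (x j - y j) ^ 2 ≤ S :=
      Finset.single_le_sum (f := fun j => (x j - y j) ^ 2) (fun _ _ => sq_nonneg _)
        (Finset.mem_univ j)
    calc _ ≤ ∑ l, LΨ ^ 2 * ((x l - y l) ^ 2 + (x j - y j) ^ 2) :=
          Finset.sum_le_sum fun l _ => sq_le_of_abs_le_mul_sqrt (by positivity) (hLip _ _ _ _)
      _ = LΨ ^ 2 * (S + m * (x j - y j) ^ 2) := by
          rw [← Finset.mul_sum, Finset.sum_add_distrib]
          simp [S]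
      _ ≤ LΨ ^ 2 * (m * S + m * S) := by
          gcongr
          exact le_mul_of_one_le_left hS hm'
      _ = 2 * m * LΨ ^ 2 * S := by ring
  calc _ ≤ ∑ j, (∑ l, K (j, l) ^ 2) * (2 * m * LΨ ^ 2 * S) := by
        refine Finset.sum_le_sum fun j _ => ?_
        have hrow : (∑ l, K (j, l) * ψ (x l)) * deriv ψ (x j)
            - (∑ l, K (j, l) * ψ (y l)) * deriv ψ (y j)
            = ∑ l, K (j, l) * (ψ (x l) * deriv ψ (x j) - ψ (y l) * deriv ψ (y j)) := by
          rw [Finset.sum_mul, Finset.sum_mul, ← Finset.sum_sub_distrib]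
          exact Finset.sum_congr rfl fun l _ => by ring
        calc _ = (∑ l, K (j, l)
              * (ψ (x l) * deriv ψ (x j) - ψ (y l) * deriv ψ (y j))) ^ 2 := by rw [← hrow]
          _ ≤ _ := Finset.sum_mul_sq_le_sq_mul_sq _ _ _
          _ ≤ _ := mul_le_mul_of_nonneg_left (hD j) (Finset.sum_nonneg fun _ _ => sq_nonneg _)
    _ = (∑ j, ∑ l, K (j, l) ^ 2) * (2 * m * LΨ ^ 2 * S) := by rw [Finset.sum_mul]
    _ ≤ UK ^ 2 * (2 * m * LΨ ^ 2
          * ((∑ k, v k ^ 2) * ∑ j, ∑ k, (W₁ j k - W₂ j k) ^ 2)) := by gcongr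
    _ = _ := by ring
end

section
/- Let F : ℝ^{m×d} × ℝ^{m×m} → ℝ be differentiable with 0 ≤ F(W,K) ≤ R for all (W,K), and with blockwise Lipschitz gradients: for every W, K ↦ ∇_K F(W,K) is Lipschitz with constant L_K, and for every K, W ↦ ∇_W F(W,K) is Lipschitz with constant L_W. Let L = max(L_W, L_K), fix η with 0 < η < 2/L, set S = η − L η²/2, and generate iterates by K^{t+1} = K^t − η ∇_K F(W^t, K^t), W^{t+1} = W^t − η ∇_W F(W^t, K^{t+1}). Then for every T ≥ 1: min_{0 ≤ t ≤ T} ( ‖∇_K F(W^t,K^t)‖_F² + ‖∇_W F(W^t,K^{t+1})‖_F² ) ≤ 2R/(S·T), i.e., the algorithm converges to a critical point at rate O(1/T). -/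
open scoped RealInnerProductSpace in
/-- Sufficient decrease of a gradient step for a function with `L`-Lipschitz gradient. -/
theorem apply_sub_smul_gradient_le {E : Type*} [NormedAddCommGroup E] [InnerProductSpace ℝ E]
    [CompleteSpace E] {f : E → ℝ} (hf : Differentiable ℝ f) {L : ℝ}
    (hL : ∀ x y, ‖gradient f x - gradient f y‖ ≤ L * ‖x - y‖) (x : E) {η : ℝ} (hη : 0 ≤ η) :
    f (x - η • gradient f x) ≤ f x - (η - L * η ^ 2 / 2) * ‖gradient f x‖ ^ 2 := by
  set g := gradient f x with hg
  have hd : ∀ s : ℝ, HasDerivAt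
      (fun s : ℝ => f (x - s • g) + (s - L * s ^ 2 / 2) * ‖g‖ ^ 2)
      (-⟪gradient f (x - s • g), g⟫ + (1 - L * s) * ‖g‖ ^ 2) s := by
    intro s
    have h1 : HasDerivAt (fun s : ℝ => x - s • g) (-g) s := by
      simpa using ((hasDerivAt_id s).smul_const g).const_sub x
    have h2 := (hf (x - s • g)).hasGradientAt.hasFDerivAt.comp_hasDerivAt s h1
    have h3 : HasDerivAt (fun s : ℝ => s - L * s ^ 2 / 2) (1 - L * s) s := by
      refine ((hasDerivAt_id s).sub
        ((((hasDerivAt_id s).pow 2).const_mul L).div_const 2)).congr_deriv ?_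
      simp
      ring
    refine (h2.add (h3.mul_const (‖g‖ ^ 2))).congr_deriv ?_
    simp
  have hanti : AntitoneOn (fun s : ℝ => f (x - s • g) + (s - L * s ^ 2 / 2) * ‖g‖ ^ 2)
      (Set.Ici 0) := by
    refine antitoneOn_of_deriv_nonpos (convex_Ici 0)
      (fun s _ => (hd s).continuousAt.continuousWithinAt)
      (fun s _ => (hd s).differentiableAt.differentiableWithinAt) fun s hs => ?_
    rw [interior_Ici, Set.mem_Ioi] at hs
    rw [(hd s).deriv]
    have h1 : ⟪g - gradient f (x - s • g), g⟫ ≤ L * s * ‖g‖ ^ 2 :=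
      calc ⟪g - gradient f (x - s • g), g⟫
          ≤ ‖g - gradient f (x - s • g)‖ * ‖g‖ := real_inner_le_norm _ _
        _ ≤ L * ‖x - (x - s • g)‖ * ‖g‖ := by gcongr; exact hL _ _
        _ = L * s * ‖g‖ ^ 2 := by
          rw [sub_sub_cancel, norm_smul, Real.norm_of_nonneg hs.le]; ring
    rw [inner_sub_left, real_inner_self_eq_norm_sq] at h1
    linarith
  have h := hanti Set.self_mem_Ici (Set.mem_Ici.2 hη) hη
  simp only [zero_smul, sub_zero] at h
  linarith

/-- `O(1/T)` convergence of alternating gradient descent with constant step size: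
if `0 ≤ F ≤ R` with blockwise Lipschitz gradients, `L = max(L_W, L_K)`, `0 < η < 2/L`,
`S = η − L η²/2`, then for every `T ≥ 1`,
`min_{0 ≤ t ≤ T} (‖∇_K F(W^t,K^t)‖² + ‖∇_W F(W^t,K^{t+1})‖²) ≤ 2R/(S T)`. -/
theorem alternating_descent_rate {m d : ℕ}
    (F : EuclideanSpace ℝ (Fin m × Fin d) → EuclideanSpace ℝ (Fin m × Fin m) → ℝ)
    (hF : Differentiable ℝ fun p : EuclideanSpace ℝ (Fin m × Fin d) ×
      EuclideanSpace ℝ (Fin m × Fin m) => F p.1 p.2)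
    (R : ℝ) (hFR : ∀ W K, 0 ≤ F W K ∧ F W K ≤ R)
    (LK LW : ℝ)
    (hLK : ∀ (W : EuclideanSpace ℝ (Fin m × Fin d))
        (K₁ K₂ : EuclideanSpace ℝ (Fin m × Fin m)),
        ‖gradient (fun K => F W K) K₁ - gradient (fun K => F W K) K₂‖ ≤ LK * ‖K₁ - K₂‖)
    (hLW : ∀ (K : EuclideanSpace ℝ (Fin m × Fin m))
        (W₁ W₂ : EuclideanSpace ℝ (Fin m × Fin d)),
        ‖gradient (fun W => F W K) W₁ - gradient (fun W => F W K) W₂‖ ≤ LW * ‖W₁ - W₂‖)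
    (L η S : ℝ) (hL : L = max LW LK) (hη : 0 < η) (hη2 : η < 2 / L)
    (hS : S = η - L * η ^ 2 / 2)
    (W : ℕ → EuclideanSpace ℝ (Fin m × Fin d))
    (K : ℕ → EuclideanSpace ℝ (Fin m × Fin m))
    (hK : ∀ t : ℕ, K (t + 1) = K t - η • gradient (fun K' => F (W t) K') (K t))
    (hW : ∀ t : ℕ, W (t + 1) = W t - η • gradient (fun W' => F W' (K (t + 1))) (W t)) :
    ∀ T : ℕ, 1 ≤ T →
      ∃ t ≤ T,
        ‖gradient (fun K' => F (W t) K') (K t)‖ ^ 2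
          + ‖gradient (fun W' => F W' (K (t + 1))) (W t)‖ ^ 2
        ≤ 2 * R / (S * (T : ℝ)) := by
  have hL0 : 0 < L := by
    by_contra! h
    linarith [div_nonpos_of_nonneg_of_nonpos zero_le_two h]
  have hS0 : 0 < S := by
    rw [lt_div_iff₀ hL0] at hη2
    rw [hS]
    nlinarith
  set G : ℕ → ℝ := fun t => ‖gradient (fun K' => F (W t) K') (K t)‖ ^ 2
    + ‖gradient (fun W' => F W' (K (t + 1))) (W t)‖ ^ 2 with hG
  have hstep : ∀ t, S * G t ≤ F (W t) (K t) - F (W (t + 1)) (K (t + 1)) := by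
    intro t
    have dK : Differentiable ℝ fun K' => F (W t) K' :=
      hF.comp ((differentiable_const (W t)).prodMk differentiable_id)
    have dW : Differentiable ℝ fun W' => F W' (K (t + 1)) :=
      hF.comp (differentiable_id.prodMk (differentiable_const (K (t + 1))))
    have h1 := apply_sub_smul_gradient_le dK (L := L) (fun x y => (hLK (W t) x y).trans <|
      mul_le_mul_of_nonneg_right (hL ▸ le_max_right _ _) (norm_nonneg _)) (K t) hη.le
    have h2 := apply_sub_smul_gradient_le dW (L := L) (fun x y => (hLW _ x y).trans <|
      mul_le_mul_of_nonneg_right (hL ▸ le_max_left _ _) (norm_nonneg _)) (W t) hη.le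
    rw [← hK, ← hS] at h1
    rw [← hW, ← hS] at h2
    simp only [hG]
    linarith
  intro T hT
  by_contra! hlt
  have hT0 : (0 : ℝ) < T := by exact_mod_cast hT
  have hsum : ∑ t ∈ Finset.range T, S * G t ≤ R :=
    calc ∑ t ∈ Finset.range T, S * G t
        ≤ ∑ t ∈ Finset.range T, (F (W t) (K t) - F (W (t + 1)) (K (t + 1))) :=
          Finset.sum_le_sum fun t _ => hstep t
      _ = F (W 0) (K 0) - F (W T) (K T) :=
          Finset.sum_range_sub' (fun t => F (W t) (K t)) T
      _ ≤ R := by linarith [(hFR (W 0) (K 0)).2, (hFR (W T) (K T)).1]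
  have hlow : 2 * R < ∑ t ∈ Finset.range T, S * G t :=
    calc 2 * R = ∑ _t ∈ Finset.range T, S * (2 * R / (S * T)) := by
          rw [Finset.sum_const, Finset.card_range, nsmul_eq_mul]
          field_simp
      _ < ∑ t ∈ Finset.range T, S * G t :=
          Finset.sum_lt_sum_of_nonempty (Finset.nonempty_range_iff.2 (by omega)) fun t ht =>
            mul_lt_mul_of_pos_left (hlt t (Finset.mem_range.1 ht).le) hS0
  linarith [(hFR (W 0) (K 0)).1, (hFR (W 0) (K 0)).2]
end

section
/- Let F : ℝ^{m×d} × ℝ^{m×m} → ℝ be differentiable with F(W,K) ≥ 0 for all (W,K), and with blockwise Lipschitz gradients: for every W, K ↦ ∇_K F(W,K) is Lipschitz with constant L_K, and for every K, W ↦ ∇_W F(W,K) is Lipschitz with constant L_W. Let L = max(L_W, L_K), fix η with 0 < η < 2/L, and generate iterates by K^{t+1} = K^t − η ∇_K F(W^t, K^t), W^{t+1} = W^t − η ∇_W F(W^t, K^{t+1}). Then ‖∇_K F(W^t,K^t)‖_F² + ‖∇_W F(W^t,K^{t+1})‖_F² → 0 as t → ∞; in particular the iteration converges asymptotically to a critical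 point without any optimal-tracking step. -/
open Filter

/-- Descent lemma along a gradient step: if `f` has `L`-Lipschitz gradient, then a gradient step of
size `η ≥ 0` decreases `f` by at least `η (1 - L η / 2) ‖∇ f x‖²`. -/
theorem apply_gradient_step_le {E : Type*} [NormedAddCommGroup E] [InnerProductSpace ℝ E]
    [CompleteSpace E] {f : E → ℝ} (hf : Differentiable ℝ f) {L : ℝ}
    (hL : ∀ x y, ‖gradient f x - gradient f y‖ ≤ L * ‖x - y‖) (x : E) {η : ℝ} (hη : 0 ≤ η) :
    f (x - η • gradient f x) ≤ f x - η * (1 - L * η / 2) * ‖gradient f x‖ ^ 2 := by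
  set g := gradient f x with hg
  have hderiv (s : ℝ) : HasDerivAt
      (fun s : ℝ => f (x - s • g) + (s - L * s ^ 2 / 2) * ‖g‖ ^ 2)
      (inner ℝ (gradient f (x - s • g)) (-g) + (1 - L * s) * ‖g‖ ^ 2) s := by
    have hline : HasDerivAt (fun s : ℝ => x - s • g) (-g) s := by
      simpa using ((hasDerivAt_id s).smul_const g).const_sub x
    have hcomp := (hf (x - s • g)).hasGradientAt.hasFDerivAt.comp_hasDerivAt s hline
    have hpoly : HasDerivAt (fun s : ℝ => s - L * s ^ 2 / 2) (1 - L * s) s := by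
      refine ((hasDerivAt_id' s).fun_sub
        (((hasDerivAt_pow 2 s).const_mul L).div_const 2)).congr_deriv ?_
      norm_num
      ring
    exact hcomp.fun_add (hpoly.mul_const (‖g‖ ^ 2))
  have hanti : AntitoneOn (fun s : ℝ => f (x - s • g) + (s - L * s ^ 2 / 2) * ‖g‖ ^ 2)
      (Set.Ici 0) := by
    refine antitoneOn_of_deriv_nonpos (convex_Ici 0)
      (fun s _ => (hderiv s).continuousAt.continuousWithinAt)
      (fun s _ => (hderiv s).differentiableAt.differentiableWithinAt) fun s hs => ?_
    rw [interior_Ici, Set.mem_Ioi] at hs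
    rw [(hderiv s).deriv]
    have hlip : ‖g - gradient f (x - s • g)‖ ≤ L * (s * ‖g‖) := by
      simpa [norm_smul, abs_of_pos hs] using hL x (x - s • g)
    have hcs := real_inner_le_norm (g - gradient f (x - s • g)) g
    rw [inner_sub_left, real_inner_self_eq_norm_sq] at hcs
    rw [inner_neg_right]
    nlinarith [mul_le_mul_of_nonneg_right hlip (norm_nonneg g)]
  have hle := hanti (Set.mem_Ici.2 le_rfl) (Set.mem_Ici.2 hη) hη
  simp only [zero_smul, sub_zero] at hle
  linarith

/-- If a nonnegative sequence decreases by at least `b t ≥ 0` at each step `t`, then `b` tends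
to `0`. -/
theorem tendsto_zero_of_le_sub {a b : ℕ → ℝ} (ha : ∀ t, 0 ≤ a t) (hb : ∀ t, 0 ≤ b t)
    (hab : ∀ t, a (t + 1) ≤ a t - b t) : Tendsto b atTop (nhds 0) := by
  refine (summable_of_sum_range_le (c := a 0) hb fun n => ?_).tendsto_atTop_zero
  have hsum : ∑ t ∈ Finset.range n, b t ≤ a 0 - a n := by
    rw [← Finset.sum_range_sub']
    exact Finset.sum_le_sum fun t _ => by linarith [hab t]
  linarith [ha n]

/-- Asymptotic convergence of alternating gradient descent with constant step size:
if `F ≥ 0` is differentiable with blockwise Lipschitz gradients, `L = max(L_W, L_K)`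
and `0 < η < 2/L`, then along the iterates
`K^{t+1} = K^t − η ∇_K F(W^t, K^t)`, `W^{t+1} = W^t − η ∇_W F(W^t, K^{t+1})`, the
quantity `‖∇_K F(W^t,K^t)‖² + ‖∇_W F(W^t,K^{t+1})‖²` tends to `0` as `t → ∞`. -/
theorem alternating_descent_gradients_tendsto_zero {m d : ℕ}
    (F : EuclideanSpace ℝ (Fin m × Fin d) → EuclideanSpace ℝ (Fin m × Fin m) → ℝ)
    (hF : Differentiable ℝ fun p : EuclideanSpace ℝ (Fin m × Fin d) ×
      EuclideanSpace ℝ (Fin m × Fin m) => F p.1 p.2)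
    (hFpos : ∀ W K, 0 ≤ F W K)
    (LK LW : ℝ)
    (hLK : ∀ (W : EuclideanSpace ℝ (Fin m × Fin d))
        (K₁ K₂ : EuclideanSpace ℝ (Fin m × Fin m)),
        ‖gradient (fun K => F W K) K₁ - gradient (fun K => F W K) K₂‖ ≤ LK * ‖K₁ - K₂‖)
    (hLW : ∀ (K : EuclideanSpace ℝ (Fin m × Fin m))
        (W₁ W₂ : EuclideanSpace ℝ (Fin m × Fin d)),
        ‖gradient (fun W => F W K) W₁ - gradient (fun W => F W K) W₂‖ ≤ LW * ‖W₁ - W₂‖)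
    (L η : ℝ) (hL : L = max LW LK) (hη : 0 < η) (hη2 : η < 2 / L)
    (W : ℕ → EuclideanSpace ℝ (Fin m × Fin d))
    (K : ℕ → EuclideanSpace ℝ (Fin m × Fin m))
    (hK : ∀ t : ℕ, K (t + 1) = K t - η • gradient (fun K' => F (W t) K') (K t))
    (hW : ∀ t : ℕ, W (t + 1) = W t - η • gradient (fun W' => F W' (K (t + 1))) (W t)) :
    Tendsto (fun t : ℕ =>
        ‖gradient (fun K' => F (W t) K') (K t)‖ ^ 2
          + ‖gradient (fun W' => F W' (K (t + 1))) (W t)‖ ^ 2)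
      atTop (nhds 0) := by
  have hLpos : 0 < L := by
    by_contra! h
    linarith [div_nonpos_of_nonneg_of_nonpos zero_le_two h]
  have hc : 0 < η * (1 - L * η / 2) := by
    rw [lt_div_iff₀ hLpos] at hη2
    exact mul_pos hη (by linarith)
  have hKstep (t : ℕ) := apply_gradient_step_le (f := fun K' => F (W t) K') (L := L)
    (hF.comp (by fun_prop : Differentiable ℝ fun K' => (W t, K')))
    (fun x y => (hLK (W t) x y).trans (by rw [hL]; gcongr; exact le_max_right _ _)) (K t) hη.le
  have hWstep (t : ℕ) := apply_gradient_step_le (f := fun W' => F W' (K (t + 1))) (L := L)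
    (hF.comp (by fun_prop : Differentiable ℝ fun W' => (W', K (t + 1))))
    (fun x y => (hLW (K (t + 1)) x y).trans (by rw [hL]; gcongr; exact le_max_left _ _))
    (W t) hη.le
  simp only [← hK] at hKstep
  simp only [← hW] at hWstep
  have hlim := tendsto_zero_of_le_sub (a := fun t => F (W t) (K t))
    (b := fun t => η * (1 - L * η / 2) * (‖gradient (fun K' => F (W t) K') (K t)‖ ^ 2
      + ‖gradient (fun W' => F W' (K (t + 1))) (W t)‖ ^ 2))
    (fun t => hFpos _ _) (fun t => by positivity)
    (fun t => by linarith [hKstep t, hWstep t])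
  simpa only [inv_mul_cancel_left₀ hc.ne', mul_zero] using hlim.const_mul (η * (1 - L * η / 2))⁻¹
end
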